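/- Let (X,d) and (Λ,ρ) be compact metric spaces, ω : Λ × X → X continuous, p a Borel probability measure on Λ, and ℙ = p^ℕ on Ω = Λ^ℕ. Suppose ω is ℙ-weakly hyperbolic, i.e., ℙ(S) = 1 where S = {σ : lim_n diam(ω_{σ_1} ∘ ⋯ ∘ ω_{σ_n}(X)) = 0}. Then for ℙ-almost every σ ∈ Ω, lim_{n→∞} (1/n) Σ_{i=1}^n diam(ω_{σ_i} ∘ ⋯ ∘ ω_{σ_1}(X)) = 0. -/

import Mathlib

open Metric Set Filter MeasureTheory

def hcomp {Λ X : Type*} (ω : Λ → X → X) (σ : ℕ → Λ) : ℕ → X → X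
  | 0 => id
  | n + 1 => hcomp ω σ n ∘ ω (σ n)

def fcomp {Λ X : Type*} (ω : Λ → X → X) (σ : ℕ → Λ) : ℕ → X → X
  | 0 => id
  | n + 1 => ω (σ n) ∘ fcomp ω σ n

def IsBernoulli {Λ : Type*} [MeasurableSpace Λ]
    (p : Measure Λ) (P : Measure (ℕ → Λ)) : Prop :=
  IsProbabilityMeasure P ∧
    ∀ (n : ℕ) (A : ℕ → Set Λ), (∀ i, MeasurableSet (A i)) →
      P {σ | ∀ i < n, σ i ∈ A i} = ∏ i ∈ Finset.range n, p (A i)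

/-- The set `S` of sequences along which the forward images have diameters tending to `0`. -/
def Sset {Λ X : Type*} [MetricSpace X] (ω : Λ → X → X) : Set (ℕ → Λ) :=
  {σ | Tendsto (fun n : ℕ => Metric.diam (Set.range (hcomp ω σ n))) atTop (nhds 0)}

/-- The set `F` of sequences along which the Cesàro averages of the diameters
`diam (ω_{σ_i} ∘ ⋯ ∘ ω_{σ_1}(X))` tend to `0`. -/
def Fset {Λ X : Type*} [MetricSpace X] (ω : Λ → X → X) : Set (ℕ → Λ) :=
  {σ | Tendsto (fun n : ℕ => ((n : ℝ))⁻¹ *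
      ∑ i ∈ Finset.range n, Metric.diam (Set.range (fcomp ω σ (i + 1))))
    atTop (nhds 0)}

open ProbabilityTheory Topology

section Composition

variable {Λ X : Type*} (ω : Λ → X → X)

lemma fcomp_add (σ : ℕ → Λ) (m n : ℕ) :
    fcomp ω σ (m + n) = fcomp ω (fun i => σ (m + i)) n ∘ fcomp ω σ m := by
  induction n with
  | zero => rfl
  | succ n ih => rw [← add_assoc]; simp only [fcomp, ih]; rfl

lemma fcomp_congr {σ τ : ℕ → Λ} {n : ℕ} (h : ∀ i < n, σ i = τ i) :
    fcomp ω σ n = fcomp ω τ n := by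
  induction n with
  | zero => rfl
  | succ n ih =>
    simp only [fcomp, h n n.lt_succ_self, ih fun i hi => h i (hi.trans n.lt_succ_self)]

lemma hcomp_eq_fcomp_reverse (σ : ℕ → Λ) (n : ℕ) :
    hcomp ω σ n = fcomp ω (fun i => σ (n - 1 - i)) n := by
  induction n with
  | zero => rfl
  | succ n ih =>
    rw [add_comm n 1, fcomp_add, add_comm 1 n, hcomp, ih]
    congr 1
    refine fcomp_congr ω fun i hi => ?_
    congr 1
    omega

end Composition

lemma continuous_fcomp {Λ X : Type*} [TopologicalSpace Λ] [TopologicalSpace X] {ω : Λ → X → X}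
    (hω : Continuous fun q : Λ × X => ω q.1 q.2) (n : ℕ) (x : X) :
    Continuous fun σ : ℕ → Λ => fcomp ω σ n x := by
  induction n with
  | zero => exact continuous_const
  | succ n ih => exact hω.comp ((continuous_apply n).prodMk ih)

/-- The reversal of the first `k` natural numbers, fixing all the others. -/
def reverseBelow (k i : ℕ) : ℕ := if i < k then k - 1 - i else i

lemma reverseBelow_injective (k : ℕ) : Function.Injective (reverseBelow k) := by
  intro i j h
  unfold reverseBelow at h
  split_ifs at h <;> omega

section Diameter

variable {X : Type*} [MetricSpace X] [CompactSpace X]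

lemma diam_le_diam_univ (A : Set X) : diam A ≤ diam (univ : Set X) :=
  diam_mono (subset_univ A) isCompact_univ.isBounded

lemma measurable_diam_range {Y : Type*} [TopologicalSpace Y] [MeasurableSpace Y]
    [OpensMeasurableSpace Y] {F : Y → X → X} (hF : ∀ x, Continuous fun y => F y x) :
    Measurable fun y => diam (range (F y)) := by
  refine measurable_of_Ioi fun c => ?_
  rcases lt_or_ge c 0 with hc | hc
  · convert! MeasurableSet.univ
    ext y
    simpa using hc.trans_le diam_nonneg
  · refine IsOpen.measurableSet ?_
    have : (fun y => diam (range (F y))) ⁻¹' Ioi c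
        = ⋃ x, ⋃ x', {y | c < dist (F y x) (F y x')} := by
      ext y
      simp only [mem_preimage, mem_Ioi, mem_iUnion, mem_ofPred_eq]
      constructor
      · intro h
        by_contra! hcon
        refine h.not_ge (diam_le_of_forall_dist_le hc ?_)
        rintro _ ⟨x, rfl⟩ _ ⟨x', rfl⟩
        exact hcon x x'
      · rintro ⟨x, x', h⟩
        exact h.trans_le (dist_le_diam_of_mem (isCompact_univ.isBounded.subset (subset_univ _))
          (mem_range_self x) (mem_range_self x'))
    rw [this]
    exact isOpen_iUnion fun x => isOpen_iUnion fun x' =>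
      isOpen_lt continuous_const ((hF x).dist (hF x'))

variable {Λ : Type*}

lemma diam_fcomp_add_le (ω : Λ → X → X) (σ : ℕ → Λ) (m n : ℕ) :
    diam (range (fcomp ω σ (m + n))) ≤ diam (range (fcomp ω (fun i => σ (m + i)) n)) := by
  rw [fcomp_add]
  exact diam_mono (range_comp_subset_range _ _) (isCompact_univ.isBounded.subset (subset_univ _))

end Diameter

lemma IsBernoulli.eq_infinitePi {Λ : Type*} [MeasurableSpace Λ] {p : Measure Λ}
    [IsProbabilityMeasure p] {P : Measure (ℕ → Λ)} (hP : IsBernoulli p P) :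
    P = Measure.infinitePi fun _ => p := by
  classical
  refine Measure.eq_infinitePi _ fun s t ht => ?_
  obtain ⟨n, hn⟩ := s.exists_nat_subset_range
  have h := hP.2 n (fun i => if i ∈ s then t i else univ) fun i => by
    split_ifs
    exacts [ht i, .univ]
  have hset : {σ : ℕ → Λ | ∀ i < n, σ i ∈ if i ∈ s then t i else univ} = Set.pi s t := by
    ext σ
    simp only [mem_ofPred_eq, Set.mem_pi, Finset.mem_coe]
    constructor
    · intro h i hi
      simpa [hi] using h i (Finset.mem_range.1 (hn hi))
    · intro h i _
      split_ifs with hi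
      exacts [h i hi, mem_univ _]
  rw [hset] at h
  rw [h, ← Finset.prod_subset hn fun i _ hi => by simp [hi]]
  exact Finset.prod_congr rfl fun i hi => by simp [hi]

section ProductMeasure

variable {Λ : Type*} [MeasurableSpace Λ] {p : Measure Λ} [IsProbabilityMeasure p]

lemma measurePreserving_comp_injective {g : ℕ → ℕ} (hg : Function.Injective g) :
    MeasurePreserving (fun (σ : ℕ → Λ) i => σ (g i)) (Measure.infinitePi fun _ => p)
      (Measure.infinitePi fun _ => p) :=
  ⟨by fun_prop, Measure.map_infinitePi_infinitePi_of_inj hg⟩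

lemma indepFun_shift {φ : (ℕ → Λ) → ℝ} (hφ : Measurable φ) {k : ℕ}
    (hk : ∀ σ τ : ℕ → Λ, (∀ i < k, σ i = τ i) → φ σ = φ τ) {m n : ℕ} (hmn : m + k ≤ n) :
    IndepFun (fun σ => φ fun i => σ (m + i)) (fun σ => φ fun i => σ (n + i))
      (Measure.infinitePi fun _ => p) := by
  classical
  obtain ⟨a⟩ := nonempty_of_isProbabilityMeasure p
  have hind : iIndepFun (fun (i : ℕ) (σ : ℕ → Λ) => σ i) (Measure.infinitePi fun _ => p) :=
    iIndepFun_infinitePi (X := fun _ x => x) fun _ => measurable_id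
  have hfin := hind.indepFun_finset (Finset.Ico m (m + k)) (Finset.Ico n (n + k))
    (by
      rw [Finset.disjoint_left]
      intro i hi hi'
      rw [Finset.mem_Ico] at hi hi'
      omega)
    fun i => measurable_pi_apply i
  let e : (m : ℕ) → (Finset.Ico m (m + k) → Λ) → ℕ → Λ := fun m v i =>
    if h : m + i ∈ Finset.Ico m (m + k) then v ⟨m + i, h⟩ else a
  have he : ∀ m, Measurable (e m) := fun m => by
    refine measurable_pi_lambda _ fun i => ?_
    by_cases h : m + i ∈ Finset.Ico m (m + k)
    · simp only [e, h, dite_true]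
      exact measurable_pi_apply _
    · simp only [e, h, dite_false]
      exact measurable_const
  have hφe : ∀ m, (fun σ : ℕ → Λ => φ fun i => σ (m + i))
      = (φ ∘ e m) ∘ fun (σ : ℕ → Λ) (i : Finset.Ico m (m + k)) => σ i := fun m => by
    funext σ
    refine hk _ _ fun i hi => ?_
    simp [e, hi]
  rw [hφe m, hφe n]
  exact hfin.comp (hφ.comp (he m)) (hφ.comp (he n))

/-- The strong law of large numbers along an arithmetic progression of shifts, for a function of
finitely many coordinates. -/
lemma strong_law_shift {φ : (ℕ → Λ) → ℝ} (hφ : Measurable φ)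
    (hint : Integrable φ (Measure.infinitePi fun _ => p)) {k : ℕ}
    (hk : ∀ σ τ : ℕ → Λ, (∀ i < k, σ i = τ i) → φ σ = φ τ) (r : ℕ) :
    ∀ᵐ σ ∂(Measure.infinitePi fun _ => p), Tendsto
      (fun n : ℕ => (∑ j ∈ Finset.range n, φ fun i => σ (r + j * k + i)) / n) atTop
      (𝓝 (∫ σ, φ σ ∂(Measure.infinitePi fun _ => p))) := by
  have hmp : ∀ m : ℕ, MeasurePreserving (fun (σ : ℕ → Λ) i => σ (m + i))
      (Measure.infinitePi fun _ => p) (Measure.infinitePi fun _ => p) :=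
    fun m => measurePreserving_comp_injective (add_right_injective m)
  have hid : ∀ m : ℕ, IdentDistrib (fun σ : ℕ → Λ => φ fun i => σ (m + i)) φ
      (Measure.infinitePi fun _ => p) (Measure.infinitePi fun _ => p) := fun m =>
    { aemeasurable_fst := (hφ.comp (hmp m).measurable).aemeasurable
      aemeasurable_snd := hφ.aemeasurable
      map_eq := by
        rw [← (hmp m).map_eq, Measure.map_map hφ (hmp m).measurable, (hmp m).map_eq]
        rfl }
  have h := strong_law_ae_real (μ := Measure.infinitePi fun _ => p)
    (fun (j : ℕ) (σ : ℕ → Λ) => φ fun i => σ (r + j * k + i))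
    ((hid _).integrable_iff.2 hint) ?_ fun j => (hid _).trans (hid _).symm
  · rwa [(hid _).integral_eq] at h
  · have hlt : ∀ i j : ℕ, i < j → r + i * k + k ≤ r + j * k := fun i j hij => by
      nlinarith [Nat.mul_le_mul_right k (Nat.succ_le_of_lt hij)]
    intro i j hij
    rcases lt_or_gt_of_ne hij with h | h
    · exact indepFun_shift hφ hk (hlt i j h)
    · exact (indepFun_shift hφ hk (hlt j i h)).symm

end ProductMeasure

lemma sum_range_mul_eq_sum_residues (d : ℕ → ℝ) (k m : ℕ) :
    ∑ i ∈ Finset.range (m * k), d i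
      = ∑ r ∈ Finset.range k, ∑ j ∈ Finset.range m, d (r + j * k) := by
  rw [Finset.sum_comm]
  induction m with
  | zero => simp
  | succ m ih =>
    rw [add_mul, one_mul, Finset.sum_range_add, Finset.sum_range_succ, ih]
    simp only [add_comm]

lemma tendsto_cesaro_zero_of_residues {d : ℕ → ℝ} (hd : ∀ i, 0 ≤ d i)
    (h : ∀ ε > 0, ∃ k > 0, ∀ r : ℕ,
      ∀ᶠ m : ℕ in atTop, ∑ j ∈ Finset.range m, d (r + j * k) ≤ m * ε) :
    Tendsto (fun n : ℕ => (n : ℝ)⁻¹ * ∑ i ∈ Finset.range n, d i) atTop (𝓝 0) := by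
  rw [Metric.tendsto_atTop']
  intro ε hε
  obtain ⟨k, hk, hr⟩ := h (ε / 3) (by positivity)
  have hall : ∀ᶠ m : ℕ in atTop, ∀ r ∈ Finset.range k,
      ∑ j ∈ Finset.range m, d (r + j * k) ≤ m * (ε / 3) :=
    (Finset.eventually_all _).2 fun r _ => hr r
  obtain ⟨N, hN⟩ := eventually_atTop.1 hall
  refine ⟨(N + 1) * k, fun n hn => ?_⟩
  have hNn : N + 1 ≤ n / k := (Nat.le_div_iff_mul_le hk).2 hn.le
  have hn0 : 0 < n := (Nat.zero_le _).trans_lt hn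
  have hkn : k ≤ n := by nlinarith
  have hlt : n ≤ (n / k + 1) * k := (Nat.lt_div_mul_add hk (a := n)).le.trans_eq (by ring)
  have hle : (n / k + 1) * k ≤ 2 * n := by nlinarith [Nat.div_mul_le_self n k]
  have hsum : ∑ i ∈ Finset.range n, d i ≤ 2 * n * (ε / 3) := by
    calc ∑ i ∈ Finset.range n, d i ≤ ∑ i ∈ Finset.range ((n / k + 1) * k), d i :=
          Finset.sum_le_sum_of_subset_of_nonneg (by simpa using hlt) fun i _ _ => hd i
      _ = ∑ r ∈ Finset.range k, ∑ j ∈ Finset.range (n / k + 1), d (r + j * k) :=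
          sum_range_mul_eq_sum_residues d k _
      _ ≤ ∑ r ∈ Finset.range k, ((n / k + 1 : ℕ) : ℝ) * (ε / 3) :=
          Finset.sum_le_sum fun r hr => hN _ (by omega) r hr
      _ = (((n / k + 1) * k : ℕ) : ℝ) * (ε / 3) := by
          rw [Finset.sum_const, Finset.card_range, nsmul_eq_mul]; push_cast; ring
      _ ≤ ((2 * n : ℕ) : ℝ) * (ε / 3) := by gcongr
      _ = 2 * n * (ε / 3) := by push_cast; ring
  have hnpos : (0 : ℝ) < n := by exact_mod_cast hn0
  have hnonneg : 0 ≤ ∑ i ∈ Finset.range n, d i := Finset.sum_nonneg fun i _ => hd i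
  rw [Real.dist_eq, sub_zero, abs_of_nonneg (by positivity), inv_mul_lt_iff₀ hnpos]
  nlinarith

theorem stmt5 {X Λ : Type*} [MetricSpace X] [CompactSpace X]
    [MetricSpace Λ] [CompactSpace Λ] [MeasurableSpace Λ] [BorelSpace Λ]
    (ω : Λ → X → X) (hω : Continuous fun q : Λ × X => ω q.1 q.2)
    (p : Measure Λ) [IsProbabilityMeasure p]
    (P : Measure (ℕ → Λ)) (hP : IsBernoulli p P) (hS : P (Sset ω) = 1) :
    ∀ᵐ σ ∂P, σ ∈ Fset ω := by
  obtain rfl := hP.eq_infinitePi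
  have hDm : ∀ k, Measurable fun σ : ℕ → Λ => diam (range (fcomp ω σ k)) :=
    fun k => measurable_diam_range (continuous_fcomp hω k)
  have hDi : ∀ k, Integrable (fun σ : ℕ → Λ => diam (range (fcomp ω σ k)))
      (Measure.infinitePi fun _ => p) := fun k =>
    .of_bound (hDm k).aestronglyMeasurable (diam (univ : Set X)) <| .of_forall fun σ => by
      rw [Real.norm_of_nonneg diam_nonneg]
      exact diam_le_diam_univ _
  have hH : ∀ k (σ : ℕ → Λ), diam (range (hcomp ω σ k))
      = diam (range (fcomp ω (fun i => σ (reverseBelow k i)) k)) := fun k σ => by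
    rw [hcomp_eq_fcomp_reverse]
    congr 2
    exact fcomp_congr ω fun i hi => by simp [reverseBelow, hi]
  have hmp : ∀ k, MeasurePreserving (fun (σ : ℕ → Λ) i => σ (reverseBelow k i))
      (Measure.infinitePi fun _ => p) (Measure.infinitePi fun _ => p) :=
    fun k => measurePreserving_comp_injective (reverseBelow_injective k)
  have hHm : ∀ k, Measurable fun σ : ℕ → Λ => diam (range (hcomp ω σ k)) := fun k => by
    simp only [hH]
    exact (hDm k).comp (hmp k).measurable
  have hHD : ∀ k, ∫ σ, diam (range (hcomp ω σ k)) ∂(Measure.infinitePi fun _ => p)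
      = ∫ σ, diam (range (fcomp ω σ k)) ∂(Measure.infinitePi fun _ => p) := fun k => by
    simp only [hH]
    rw [← (hmp k).map_eq, integral_map (hmp k).aemeasurable (hDm k).aestronglyMeasurable,
      (hmp k).map_eq]
  have hSae : ∀ᵐ σ ∂(Measure.infinitePi fun _ => p), σ ∈ Sset ω :=
    (mem_ae_iff_prob_eq_one (measurableSet_tendsto (𝓝 0) hHm)).2 hS
  have hlim : Tendsto
      (fun k => ∫ σ, diam (range (fcomp ω σ k)) ∂(Measure.infinitePi fun _ => p))
      atTop (𝓝 0) := by
    simp only [← hHD]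
    rw [← integral_zero (ℕ → Λ) ℝ (μ := Measure.infinitePi fun _ => p)]
    refine tendsto_integral_of_dominated_convergence (fun _ => diam (univ : Set X))
      (fun k => (hHm k).aestronglyMeasurable) (integrable_const _)
      (fun k => .of_forall fun σ => ?_) hSae
    rw [Real.norm_of_nonneg diam_nonneg]
    exact diam_le_diam_univ _
  have hslln : ∀ᵐ σ ∂(Measure.infinitePi fun _ => p), ∀ k r : ℕ, Tendsto
      (fun n : ℕ => (∑ j ∈ Finset.range n,
        diam (range (fcomp ω (fun i => σ (r + j * k + i)) k))) / n) atTop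
      (𝓝 (∫ σ, diam (range (fcomp ω σ k)) ∂(Measure.infinitePi fun _ => p))) :=
    ae_all_iff.2 fun k => ae_all_iff.2 fun r =>
      strong_law_shift (hDm k) (hDi k) (fun σ τ h => by rw [fcomp_congr ω h]) r
  filter_upwards [hslln] with σ hσ
  refine tendsto_cesaro_zero_of_residues (fun i => diam_nonneg) fun ε hε => ?_
  obtain ⟨k, hk, hkpos⟩ := ((hlim.eventually_lt_const (half_pos hε)).and
    (eventually_gt_atTop 0)).exists
  refine ⟨k, hkpos, fun r => ?_⟩
  have hM : ∀ᶠ m : ℕ in atTop, diam (univ : Set X) ≤ m * (ε / 2) := by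
    filter_upwards [eventually_ge_atTop ⌈diam (univ : Set X) / (ε / 2)⌉₊] with m hm
    exact (div_le_iff₀ (half_pos hε)).1 (Nat.ceil_le.1 hm)
  filter_upwards [(hσ k (r + 1)).eventually_lt_const hk, hM, eventually_gt_atTop 0]
    with m hm hMm hm0
  have hmpos : (0 : ℝ) < m := by exact_mod_cast hm0
  rw [div_lt_iff₀ hmpos] at hm
  calc ∑ j ∈ Finset.range m, diam (range (fcomp ω σ (r + j * k + 1)))
      ≤ ∑ j ∈ Finset.range (m + 1), diam (range (fcomp ω σ (r + j * k + 1))) :=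
        Finset.sum_le_sum_of_subset_of_nonneg (by simp) fun _ _ _ => diam_nonneg
    _ = ∑ j ∈ Finset.range m, diam (range (fcomp ω σ (r + (j + 1) * k + 1)))
        + diam (range (fcomp ω σ (r + 0 * k + 1))) := Finset.sum_range_succ' _ _
    _ ≤ ∑ j ∈ Finset.range m, diam (range (fcomp ω (fun i => σ (r + 1 + j * k + i)) k))
        + diam (univ : Set X) := by
        refine add_le_add (Finset.sum_le_sum fun j _ => ?_) (diam_le_diam_univ _)
        rw [show r + (j + 1) * k + 1 = r + 1 + j * k + k by ring]
        exact diam_fcomp_add_le ω σ _ k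
    _ ≤ m * ε := by linarith
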